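/- (Final exchangeable coalgebra) Let X be a measurable space and let h be a Markov kernel from X to Bool × X that is exchangeable, meaning that for every x ∈ X the law of (first output, second output, final state) under two successive steps of h equals the law of (second output, first output, final state). Let coin be the Markov kernel from [0,1] to Bool × [0,1] given by coin(r) = r · δ(true, r) + (1−r) · δ(false, r). Then there exists a unique Markov kernel f from X to [0,1] such that for every x ∈ X, the composite coin ∘ f at x equals the pushforward of h(x) along (id_Bool × f): i.e. (coin applied after sampling from f(x)) = (sample (b,y) from h(x), then output (b, sample from f(y))) as measures on Bool × [0,1]. Hence coin is the final exchangeable coalgebra for the functor Bool × (−) on the Kleisli category of the Giry monad. -/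

import Mathlib

open MeasureTheory ProbabilityTheory
open scoped ENNReal

/-- A Markov-kernel coalgebra `h : X ⤳ Bool × X` is exchangeable if for every `x` the
law of (first output, second output, final state) under two successive steps equals
the law of (second output, first output, final state). -/
def ExchangeableKernel {X : Type*} [MeasurableSpace X] (h : Kernel X (Bool × X)) : Prop :=
  ∀ x : X,
    ((h x).bind fun p => (h p.2).map fun q => (p.1, q.1, q.2))
      = (h x).bind fun p => (h p.2).map fun q => (q.1, p.1, q.2)

/-- The Bernoulli coalgebra `coin : [0,1] ⤳ Bool × [0,1]`,
`coin(r) = r·δ(true,r) + (1−r)·δ(false,r)`. -/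
noncomputable def coin (r : Set.Icc (0 : ℝ) 1) : Measure (Bool × Set.Icc (0 : ℝ) 1) :=
  ENNReal.ofReal (r : ℝ) • Measure.dirac (true, r)
    + ENNReal.ofReal (1 - (r : ℝ)) • Measure.dirac (false, r)

open Filter Topology unitInterval

theorem bernsteinPolynomial_mul_derivative (n k : ℕ) :
    Polynomial.X * (1 - Polynomial.X) * (bernsteinPolynomial ℝ n k).derivative
      = ((k : Polynomial ℝ) - (n : Polynomial ℝ) * Polynomial.X) * bernsteinPolynomial ℝ n k := by
  rcases lt_or_ge n k with hnk | hnk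
  · simp [bernsteinPolynomial.eq_zero_of_lt ℝ hnk]
  obtain ⟨m, rfl⟩ := Nat.exists_eq_add_of_le hnk
  have e1 : (Polynomial.X : Polynomial ℝ) * Polynomial.derivative (Polynomial.X ^ k)
      = (k : Polynomial ℝ) * Polynomial.X ^ k := by
    cases k with
    | zero => simp
    | succ k => simp; ring
  have e2 : (1 - Polynomial.X : Polynomial ℝ) * Polynomial.derivative ((1 - Polynomial.X) ^ m)
      = -(m : Polynomial ℝ) * (1 - Polynomial.X) ^ m := by
    cases m with
    | zero => simp
    | succ m => simp [Polynomial.derivative_pow]; ring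
  simp only [bernsteinPolynomial, Nat.add_sub_cancel_left, Polynomial.derivative_mul,
    Polynomial.derivative_natCast]
  push_cast
  linear_combination ((k + m).choose k : Polynomial ℝ) * (1 - Polynomial.X) ^ (m + 1) * e1
    + ((k + m).choose k : Polynomial ℝ) * Polynomial.X ^ (k + 1) * e2

/-- The Bernstein operators converge to the identity on monomials, tested against any linear
functional on polynomials. -/
theorem tendsto_sum_pow_mul_bernsteinPolynomial (j : ℕ) (L : Polynomial ℝ →ₗ[ℝ] ℝ) :
    Tendsto (fun n : ℕ ↦ ∑ k ∈ Finset.range (n + 1),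
        ((k : ℝ) / n) ^ j * L (bernsteinPolynomial ℝ n k)) atTop
      (𝓝 (L (Polynomial.X ^ j))) := by
  induction j generalizing L with
  | zero =>
    simp only [pow_zero, one_mul, ← map_sum, bernsteinPolynomial.sum]
    exact tendsto_const_nhds
  | succ j ih =>
    let M := L ∘ₗ LinearMap.mulLeft ℝ Polynomial.X
    let D := L ∘ₗ LinearMap.mulLeft ℝ (Polynomial.X * (1 - Polynomial.X)) ∘ₗ Polynomial.derivative
    have key := (ih M).add (tendsto_inv_atTop_nhds_zero_nat (𝕜 := ℝ) |>.mul (ih D))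
    rw [zero_mul, add_zero] at key
    have e : M (Polynomial.X ^ j) = L (Polynomial.X ^ (j + 1)) := by simp [M, pow_succ']
    rw [e] at key
    refine key.congr' ?_
    filter_upwards [eventually_ne_atTop 0] with n hn
    rw [Finset.mul_sum, ← Finset.sum_add_distrib]
    refine Finset.sum_congr rfl fun k _ ↦ ?_
    have hD : D (bernsteinPolynomial ℝ n k)
        = k * L (bernsteinPolynomial ℝ n k) - n * M (bernsteinPolynomial ℝ n k) := by
      have : Polynomial.X * (1 - Polynomial.X) * (bernsteinPolynomial ℝ n k).derivative
          = (k : ℝ) • bernsteinPolynomial ℝ n k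
            - (n : ℝ) • (Polynomial.X * bernsteinPolynomial ℝ n k) := by
        rw [bernsteinPolynomial_mul_derivative]
        simp only [Polynomial.smul_eq_C_mul, map_natCast]
        ring
      simp only [D, M, LinearMap.comp_apply, LinearMap.mulLeft_apply, this, map_sub, map_smul,
        smul_eq_mul]
    have hn' : (n : ℝ) ≠ 0 := by exact_mod_cast hn
    rw [hD]
    linear_combination -((k : ℝ) / n) ^ j * M (bernsteinPolynomial ℝ n k) * inv_mul_cancel₀ hn'

/-- The Hausdorff moment problem: a completely monotone sequence is the moment sequence of a
probability measure on the unit interval. -/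
theorem exists_probabilityMeasure_integral_pow_eq (c : ℕ → ℕ → ℝ) (hc : ∀ n m, 0 ≤ c n m)
    (h0 : c 0 0 = 1) (hadd : ∀ n m, c n m = c (n + 1) m + c n (m + 1)) :
    ∃ μ : ProbabilityMeasure I, ∀ n, ∫ r : I, (r : ℝ) ^ n ∂(μ : Measure I) = c n 0 := by
  let L : Polynomial ℝ →ₗ[ℝ] ℝ := (Polynomial.basisMonomials ℝ).constr ℝ fun n ↦ c n 0
  have hL0 (n : ℕ) : L (Polynomial.X ^ n) = c n 0 := by
    have := (Polynomial.basisMonomials ℝ).constr_basis ℝ (fun n ↦ c n 0) n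
    simpa only [Polynomial.coe_basisMonomials, ← Polynomial.X_pow_eq_monomial] using this
  have hL (m n : ℕ) : L (Polynomial.X ^ n * (1 - Polynomial.X) ^ m) = c n m := by
    induction m generalizing n with
    | zero => simp [hL0]
    | succ m ih =>
      have : (Polynomial.X : Polynomial ℝ) ^ n * (1 - Polynomial.X) ^ (m + 1)
        = Polynomial.X ^ n * (1 - Polynomial.X) ^ m
          - Polynomial.X ^ (n + 1) * (1 - Polynomial.X) ^ m := by ring
      rw [this, map_sub, ih, ih, hadd n m]
      ring
  have hpos (n k : ℕ) : 0 ≤ L (bernsteinPolynomial ℝ n k) := by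
    have : bernsteinPolynomial ℝ n k
        = (n.choose k : ℝ) • (Polynomial.X ^ k * (1 - Polynomial.X) ^ (n - k)) := by
      simp [bernsteinPolynomial, Polynomial.smul_eq_C_mul, mul_assoc]
    rw [this, map_smul, hL]
    exact mul_nonneg (Nat.cast_nonneg _) (hc _ _)
  let ν (n : ℕ) : Measure I := ∑ k : Fin (n + 1),
    ENNReal.ofReal (L (bernsteinPolynomial ℝ n k)) • Measure.dirac (bernstein.z k)
  have hν (n : ℕ) : IsProbabilityMeasure (ν n) := by
    constructor
    simp only [ν, Measure.coe_finsetSum, Finset.sum_apply, Measure.smul_apply, measure_univ,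
      smul_eq_mul, mul_one]
    rw [← ENNReal.ofReal_sum_of_nonneg fun _ _ ↦ hpos _ _, ← map_sum,
      Fin.sum_univ_eq_sum_range (fun k ↦ bernsteinPolynomial ℝ n k), bernsteinPolynomial.sum,
      ← pow_zero Polynomial.X, hL0, h0, ENNReal.ofReal_one]
  have hmom (n j : ℕ) : ∫ r : I, (r : ℝ) ^ j ∂(ν n)
      = ∑ k ∈ Finset.range (n + 1), ((k : ℝ) / n) ^ j * L (bernsteinPolynomial ℝ n k) := by
    rw [integral_finsetSum_measure, ← Fin.sum_univ_eq_sum_range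
      (fun k ↦ ((k : ℝ) / n) ^ j * L (bernsteinPolynomial ℝ n k))]
    · refine Finset.sum_congr rfl fun k _ ↦ ?_
      rw [integral_smul_measure, integral_dirac, ENNReal.toReal_ofReal (hpos _ _), smul_eq_mul,
        mul_comm]
      rfl
    · intro k _
      exact (integrable_dirac (by simp)).smul_measure ENNReal.ofReal_ne_top
  let P (n : ℕ) : ProbabilityMeasure I := ⟨ν n, hν n⟩
  obtain ⟨μ, -, hμ⟩ := isCompact_univ.ultrafilter_le_nhds
    ((Ultrafilter.of (atTop : Filter ℕ)).map P) (by simp)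
  refine ⟨μ, fun j ↦ ?_⟩
  have hlim : Tendsto P (Ultrafilter.of (atTop : Filter ℕ)) (𝓝 μ) := hμ
  let φ : BoundedContinuousFunction I ℝ :=
    BoundedContinuousFunction.mkOfCompact ⟨fun r : I ↦ (r : ℝ) ^ j, by fun_prop⟩
  have h1 := ProbabilityMeasure.tendsto_iff_forall_integral_tendsto.1 hlim φ
  have h2 := (tendsto_sum_pow_mul_bernsteinPolynomial j L).mono_left (Ultrafilter.of_le atTop)
  rw [hL0] at h2
  refine tendsto_nhds_unique h1 (h2.congr fun n ↦ (hmom n j).symm)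

theorem integrable_pow_unitInterval (μ : Measure I) [IsFiniteMeasure μ] (n : ℕ) :
    Integrable (fun r : I ↦ (r : ℝ) ^ n) μ :=
  (BoundedContinuousFunction.mkOfCompact ⟨fun r : I ↦ (r : ℝ) ^ n, by fun_prop⟩).integrable μ

/-- Integrals of continuous functions on the unit interval are limits of expressions in the
moments. -/
theorem tendsto_sum_integral_bernstein (μ : Measure I) [IsFiniteMeasure μ] (φ : C(I, ℝ)) :
    Tendsto (fun n : ℕ ↦ ∑ k : Fin (n + 1), ∑ i ∈ Finset.range
        ((bernsteinPolynomial ℝ n k).natDegree + 1),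
        φ (bernstein.z k) * ((bernsteinPolynomial ℝ n k).coeff i * ∫ r : I, (r : ℝ) ^ i ∂μ))
      atTop (𝓝 (∫ r, φ r ∂μ)) := by
  have hφ := bernsteinApproximation_uniform φ
  have hint (ψ : C(I, ℝ)) : Integrable ψ μ :=
    (BoundedContinuousFunction.mkOfCompact ψ).integrable μ
  have hlim : Tendsto (fun n ↦ ∫ r, bernsteinApproximation n φ r ∂μ) atTop
      (𝓝 (∫ r, φ r ∂μ)) := by
    obtain ⟨C, hC⟩ := hφ.norm.isBoundedUnder_le
    refine tendsto_integral_filter_of_norm_le_const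
      (Eventually.of_forall fun n ↦ (hint _).aestronglyMeasurable)
      ⟨C, (eventually_map.1 hC).mono fun n hn ↦ ae_of_all _ fun r ↦
        (ContinuousMap.norm_coe_le_norm _ r).trans hn⟩ (ae_of_all _ fun r ↦ ?_)
    exact ((continuous_eval_const r).tendsto φ).comp hφ
  refine hlim.congr fun n ↦ ?_
  simp only [bernsteinApproximation.apply, smul_eq_mul]
  rw [integral_finsetSum _ fun (k : Fin (n + 1)) _ ↦ (hint (bernstein n k)).mul_const _]
  refine Finset.sum_congr rfl fun k _ ↦ ?_
  simp only [bernstein, Polynomial.toContinuousMapOn_apply, Polynomial.toContinuousMap_apply,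
    Polynomial.eval_eq_sum_range]
  rw [integral_mul_const, integral_finsetSum _ fun i _ ↦
    (integrable_pow_unitInterval μ i).const_mul _, Finset.sum_mul]
  refine Finset.sum_congr rfl fun i _ ↦ ?_
  rw [integral_const_mul, mul_comm]

theorem ext_of_forall_integral_pow_eq {μ ν : Measure I} [IsFiniteMeasure μ] [IsFiniteMeasure ν]
    (h : ∀ n : ℕ, ∫ r : I, (r : ℝ) ^ n ∂μ = ∫ r : I, (r : ℝ) ^ n ∂ν) : μ = ν := by
  refine ext_of_forall_integral_eq_of_IsFiniteMeasure fun φ ↦ ?_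
  have h1 := tendsto_sum_integral_bernstein μ φ.toContinuousMap
  simp only [h] at h1
  exact tendsto_nhds_unique h1 (tendsto_sum_integral_bernstein ν φ.toContinuousMap)

theorem measurable_of_forall_measurable_integral_pow {X : Type*} [MeasurableSpace X]
    {f : X → Measure I} [∀ x, IsProbabilityMeasure (f x)]
    (h : ∀ n : ℕ, Measurable fun x ↦ ∫ r : I, (r : ℝ) ^ n ∂(f x)) : Measurable f := by
  have hφ (φ : C(I, ℝ)) : Measurable fun x ↦ ∫ r, φ r ∂(f x) := by
    refine measurable_of_tendsto_metrizable (fun n ↦ ?_)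
      (tendsto_pi_nhds.2 fun x ↦ tendsto_sum_integral_bernstein (f x) φ)
    fun_prop
  refine Measurable.measure_of_isPiSystem_of_isProbabilityMeasure
    ((BorelSpace.measurable_eq (α := I)).trans borel_eq_generateFrom_isClosed)
    isPiSystem_isClosed fun F hF ↦ ?_
  refine measurable_of_tendsto_metrizable (fun n ↦ ?_) (tendsto_pi_nhds.2 fun x ↦
    tendsto_lintegral_thickenedIndicator_of_isClosed (f x) hF
      (δs := fun n : ℕ ↦ 1 / ((n : ℝ) + 1)) (fun n ↦ by positivity)
      tendsto_one_div_add_atTop_nhds_zero_nat)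
  simp only [lintegral_coe_eq_integral _ (integrable_thickenedIndicator _ _)]
  exact (hφ ⟨fun r ↦ (thickenedIndicator _ F r : ℝ), by fun_prop⟩).ennreal_ofReal

/-- The weakest-precondition operator of a coalgebra: `outputIntegral h b φ x` is the integral of
`φ` over the next state of `x`, on the event that the output is `b`. -/
noncomputable def outputIntegral {X : Type*} [MeasurableSpace X] (h : Kernel X (Bool × X))
    (b : Bool) (φ : X → ℝ≥0∞) (x : X) : ℝ≥0∞ :=
  ∫⁻ p, (if p.1 = b then φ p.2 else 0) ∂(h x)

section OutputIntegral

variable {X : Type*} [MeasurableSpace X] {h : Kernel X (Bool × X)}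

theorem measurable_map_kernel_snd {W Y Z : Type*} [MeasurableSpace W] [MeasurableSpace Y]
    [MeasurableSpace Z] (κ : Kernel X Y) [IsSFiniteKernel κ] {g : (W × X) × Y → Z}
    (hg : Measurable g) :
    Measurable fun p : W × X ↦ (κ p.2).map fun y ↦ g (p, y) := by
  refine Measure.measurable_of_measurable_coe _ fun s hs ↦ ?_
  have hgp (p : W × X) : Measurable fun y ↦ g (p, y) := hg.comp measurable_prodMk_left
  simp only [Measure.map_apply (hgp _) hs]
  exact Kernel.measurable_kernel_prodMk_left (κ := κ.comap Prod.snd measurable_snd) (hg hs)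

theorem lintegral_bind_map_kernel_snd {W Y Z : Type*} [MeasurableSpace W] [MeasurableSpace Y]
    [MeasurableSpace Z] (μ : Measure (W × X)) (κ : Kernel X Y) [IsSFiniteKernel κ]
    {g : (W × X) × Y → Z} (hg : Measurable g) {u : Z → ℝ≥0∞} (hu : Measurable u) :
    ∫⁻ z, u z ∂(μ.bind fun p ↦ (κ p.2).map fun y ↦ g (p, y))
      = ∫⁻ p, ∫⁻ y, u (g (p, y)) ∂(κ p.2) ∂μ := by
  rw [Measure.lintegral_bind (measurable_map_kernel_snd κ hg).aemeasurable hu.aemeasurable]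
  exact lintegral_congr fun p ↦ lintegral_map hu (hg.comp measurable_prodMk_left)

theorem measurable_ite_fst_eq {Y : Type*} [MeasurableSpace Y] (b : Bool) {φ : Y → ℝ≥0∞}
    (hφ : Measurable φ) : Measurable fun p : Bool × Y ↦ if p.1 = b then φ p.2 else 0 :=
  Measurable.ite (measurable_fst (measurableSet_singleton b)) (hφ.comp measurable_snd)
    measurable_const

theorem measurable_outputIntegral (b : Bool) {φ : X → ℝ≥0∞} (hφ : Measurable φ) :
    Measurable (outputIntegral h b φ) :=
  (measurable_ite_fst_eq b hφ).lintegral_kernel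

theorem outputIntegral_add (b : Bool) {φ ψ : X → ℝ≥0∞} (hφ : Measurable φ) :
    outputIntegral h b (φ + ψ) = outputIntegral h b φ + outputIntegral h b ψ := by
  ext x
  simp only [outputIntegral, Pi.add_apply]
  rw [← lintegral_add_left (measurable_ite_fst_eq b hφ)]
  congr with p
  split_ifs <;> simp

theorem outputIntegral_true_one_add_false_one [IsMarkovKernel h] :
    outputIntegral h true 1 + outputIntegral h false 1 = 1 := by
  ext x
  simp only [outputIntegral, Pi.add_apply, Pi.one_apply]
  rw [← lintegral_add_left (measurable_ite_fst_eq true measurable_const)]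
  have (p : Bool × X) :
      ((if p.1 = true then 1 else 0) + if p.1 = false then 1 else 0 : ℝ≥0∞) = 1 := by
    cases p.1 <;> simp
  simp [this]

theorem ExchangeableKernel.outputIntegral_comm [IsMarkovKernel h] (hex : ExchangeableKernel h)
    (a b : Bool) {φ : X → ℝ≥0∞} (hφ : Measurable φ) :
    outputIntegral h a (outputIntegral h b φ) = outputIntegral h b (outputIntegral h a φ) := by
  have key (u : Bool × Bool × X → ℝ≥0∞) (hu : Measurable u) (x : X) :
      ∫⁻ p, ∫⁻ q, u (p.1, q.1, q.2) ∂(h p.2) ∂(h x)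
        = ∫⁻ p, ∫⁻ q, u (q.1, p.1, q.2) ∂(h p.2) ∂(h x) := by
    have hx := congrArg (fun ρ ↦ ∫⁻ t, u t ∂ρ) (hex x)
    rwa [lintegral_bind_map_kernel_snd (h x) h
        (g := fun t : (Bool × X) × (Bool × X) ↦ (t.1.1, t.2.1, t.2.2)) (by fun_prop) hu,
      lintegral_bind_map_kernel_snd (h x) h
        (g := fun t : (Bool × X) × (Bool × X) ↦ (t.2.1, t.1.1, t.2.2)) (by fun_prop) hu] at hx
  have hu : Measurable fun t : Bool × Bool × X ↦
      if t.1 = a then (if t.2.1 = b then φ t.2.2 else 0) else 0 :=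
    measurable_ite_fst_eq a (measurable_ite_fst_eq b hφ)
  ext x
  have hx := key _ hu x
  simp only [outputIntegral]
  convert hx using 3 with p p
  · split_ifs <;> simp
  · split_ifs <;> simp

theorem measurable_coin : Measurable coin := by
  refine Measure.measurable_of_measurable_coe _ fun s hs ↦ ?_
  have hs' (b : Bool) : Measurable fun r : I ↦ s.indicator (1 : Bool × I → ℝ≥0∞) (b, r) :=
    (measurable_one.indicator hs).comp measurable_prodMk_left
  simp only [coin, Measure.add_apply, Measure.smul_apply, Measure.dirac_apply' _ hs, smul_eq_mul]
  exact ((by fun_prop : Measurable fun r : I ↦ ENNReal.ofReal (r : ℝ)).mul (hs' true)).add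
    ((by fun_prop : Measurable fun r : I ↦ ENNReal.ofReal (1 - (r : ℝ))).mul (hs' false))

theorem isProbabilityMeasure_coin (r : I) : IsProbabilityMeasure (coin r) := by
  constructor
  simp only [coin, Measure.add_apply, Measure.smul_apply, measure_univ, smul_eq_mul, mul_one]
  rw [← ENNReal.ofReal_add r.2.1 (sub_nonneg.2 r.2.2), add_sub_cancel, ENNReal.ofReal_one]

theorem lintegral_bind_coin (μ : Measure I) (b : Bool) {φ : I → ℝ≥0∞} (hφ : Measurable φ) :
    ∫⁻ p, (if p.1 = b then φ p.2 else 0) ∂(μ.bind coin)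
      = ∫⁻ r, ENNReal.ofReal (if b then (r : ℝ) else 1 - r) * φ r ∂μ := by
  rw [Measure.lintegral_bind measurable_coin.aemeasurable (measurable_ite_fst_eq b hφ).aemeasurable]
  congr with r
  cases b <;> simp [coin]

theorem lintegral_bind_map (f : Kernel X I) [IsMarkovKernel f] (x : X) (b : Bool) {φ : I → ℝ≥0∞}
    (hφ : Measurable φ) :
    ∫⁻ p, (if p.1 = b then φ p.2 else 0) ∂((h x).bind fun p ↦ (f p.2).map fun r ↦ (p.1, r))
      = outputIntegral h b (fun y ↦ ∫⁻ r, φ r ∂(f y)) x := by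
  rw [lintegral_bind_map_kernel_snd (h x) f (g := fun t : (Bool × X) × I ↦ (t.1.1, t.2))
    (by fun_prop) (measurable_ite_fst_eq b hφ)]
  refine lintegral_congr fun p ↦ ?_
  split_ifs <;> simp

end OutputIntegral

theorem ext_of_forall_lintegral_pow_eq {μ ν : Measure I} [IsFiniteMeasure μ] [IsFiniteMeasure ν]
    (h : ∀ n : ℕ, ∫⁻ r : I, ENNReal.ofReal ((r : ℝ) ^ n) ∂μ
      = ∫⁻ r : I, ENNReal.ofReal ((r : ℝ) ^ n) ∂ν) : μ = ν := by
  refine ext_of_forall_integral_pow_eq fun n ↦ ?_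
  have hnn (ρ : Measure I) : 0 ≤ᵐ[ρ] fun r : I ↦ (r : ℝ) ^ n :=
    ae_of_all _ fun r ↦ pow_nonneg r.2.1 n
  rw [integral_eq_lintegral_of_nonneg_ae (hnn μ) (by fun_prop),
    integral_eq_lintegral_of_nonneg_ae (hnn ν) (by fun_prop), h]

theorem ext_bool_prod_of_forall_lintegral_pow_eq {μ ν : Measure (Bool × I)} [IsFiniteMeasure μ]
    [IsFiniteMeasure ν]
    (h : ∀ (b : Bool) (n : ℕ),
      ∫⁻ p, (if p.1 = b then ENNReal.ofReal ((p.2 : ℝ) ^ n) else 0) ∂μ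
        = ∫⁻ p, (if p.1 = b then ENNReal.ofReal ((p.2 : ℝ) ^ n) else 0) ∂ν) : μ = ν := by
  have hset (b : Bool) : MeasurableSet {p : Bool × I | p.1 = b} :=
    measurable_fst (measurableSet_singleton b)
  have hfib (b : Bool) : (μ.restrict {p | p.1 = b}).map Prod.snd
      = (ν.restrict {p | p.1 = b}).map Prod.snd := by
    refine ext_of_forall_lintegral_pow_eq fun n ↦ ?_
    rw [lintegral_map (by fun_prop) measurable_snd, lintegral_map (by fun_prop) measurable_snd,
      ← lintegral_indicator (hset b), ← lintegral_indicator (hset b)]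
    simpa only [Set.indicator_apply, Set.mem_ofPred_eq] using h b n
  ext s hs
  have hsec (b : Bool) : MeasurableSet (Prod.mk b ⁻¹' s) := measurable_prodMk_left hs
  have hdecomp (ρ : Measure (Bool × I)) :
      ρ s = ∑ b, (ρ.restrict {p | p.1 = b}).map Prod.snd (Prod.mk b ⁻¹' s) := by
    have hinter (b : Bool) : Prod.snd ⁻¹' (Prod.mk b ⁻¹' s) ∩ {p : Bool × I | p.1 = b}
        = s ∩ {p | p.1 = b} := by
      ext ⟨c, r⟩
      simp only [Set.mem_inter_iff, Set.mem_preimage]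
      exact and_congr_left fun hc : c = b ↦ by rw [hc]
    simp only [Fintype.sum_bool, Measure.map_apply measurable_snd (hsec _),
      Measure.restrict_apply (measurable_snd (hsec _)), hinter]
    rw [← measure_inter_add_sdiff s (hset true)]
    congr 2
    ext p
    simp
  rw [hdecomp, hdecomp]
  simp only [hfib]

/-- A kernel into the unit interval is a homomorphism into `coin` exactly when its moments satisfy
the corresponding recursions. -/
theorem bind_coin_eq_bind_map_iff {X : Type*} [MeasurableSpace X] {h : Kernel X (Bool × X)}
    [IsMarkovKernel h] (f : Kernel X I) [IsMarkovKernel f] (x : X) :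
    ((f x).bind coin = (h x).bind fun p ↦ (f p.2).map fun r ↦ (p.1, r)) ↔
      ∀ (b : Bool) (n : ℕ),
        ∫⁻ r : I, ENNReal.ofReal (if b then (r : ℝ) else 1 - r) * ENNReal.ofReal ((r : ℝ) ^ n) ∂f x
          = outputIntegral h b (fun y ↦ ∫⁻ r : I, ENNReal.ofReal ((r : ℝ) ^ n) ∂f y) x := by
  have hm (n : ℕ) : Measurable fun r : I ↦ ENNReal.ofReal ((r : ℝ) ^ n) := by fun_prop
  constructor
  · intro hf b n
    rw [← lintegral_bind_coin _ b (hm n), hf, lintegral_bind_map f x b (hm n)]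
  · intro hf
    have : IsProbabilityMeasure ((f x).bind coin) :=
      isProbabilityMeasure_bind measurable_coin.aemeasurable (ae_of_all _ isProbabilityMeasure_coin)
    have : IsProbabilityMeasure ((h x).bind fun p ↦ (f p.2).map fun r ↦ (p.1, r)) :=
      isProbabilityMeasure_bind (measurable_map_kernel_snd f
        (g := fun t : (Bool × X) × I ↦ (t.1.1, t.2)) (by fun_prop)).aemeasurable
        (ae_of_all _ fun p ↦ Measure.isProbabilityMeasure_map (by fun_prop))
    refine ext_bool_prod_of_forall_lintegral_pow_eq fun b n ↦ ?_
    rw [lintegral_bind_coin _ b (hm n), hf, lintegral_bind_map f x b (hm n)]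

/-- The probability that the first `n + m` outputs are `n` times `true`, then `m` times
`false`. -/
noncomputable def wordProbability {X : Type*} [MeasurableSpace X] (h : Kernel X (Bool × X))
    (n m : ℕ) : X → ℝ≥0∞ :=
  (outputIntegral h true)^[n] ((outputIntegral h false)^[m] 1)

section WordProbability

variable {X : Type*} [MeasurableSpace X] {h : Kernel X (Bool × X)}

theorem measurable_iterate_outputIntegral (b : Bool) (n : ℕ) {φ : X → ℝ≥0∞} (hφ : Measurable φ) :
    Measurable ((outputIntegral h b)^[n] φ) := by
  induction n with
  | zero => exact hφ
  | succ n ih =>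
    rw [Function.iterate_succ_apply']
    exact measurable_outputIntegral b ih

theorem measurable_wordProbability (n m : ℕ) : Measurable (wordProbability h n m) :=
  measurable_iterate_outputIntegral _ _ (measurable_iterate_outputIntegral _ _ measurable_one)

theorem iterate_outputIntegral_add (b : Bool) (n : ℕ) {φ ψ : X → ℝ≥0∞} (hφ : Measurable φ) :
    (outputIntegral h b)^[n] (φ + ψ)
      = (outputIntegral h b)^[n] φ + (outputIntegral h b)^[n] ψ := by
  induction n with
  | zero => rfl
  | succ n ih =>
    simp only [Function.iterate_succ_apply', ih]
    exact outputIntegral_add b (measurable_iterate_outputIntegral b n hφ)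

theorem ExchangeableKernel.outputIntegral_iterate_comm [IsMarkovKernel h]
    (hex : ExchangeableKernel h) (a b : Bool) (n : ℕ) {φ : X → ℝ≥0∞} (hφ : Measurable φ) :
    outputIntegral h a ((outputIntegral h b)^[n] φ)
      = (outputIntegral h b)^[n] (outputIntegral h a φ) := by
  induction n with
  | zero => rfl
  | succ n ih =>
    rw [Function.iterate_succ_apply', Function.iterate_succ_apply',
      hex.outputIntegral_comm a b (measurable_iterate_outputIntegral b n hφ), ih]

theorem wordProbability_zero_zero : wordProbability h 0 0 = 1 := rfl

theorem outputIntegral_true_wordProbability (n m : ℕ) :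
    outputIntegral h true (wordProbability h n m) = wordProbability h (n + 1) m :=
  (Function.iterate_succ_apply' _ _ _).symm

theorem ExchangeableKernel.outputIntegral_false_wordProbability [IsMarkovKernel h]
    (hex : ExchangeableKernel h) (n m : ℕ) :
    outputIntegral h false (wordProbability h n m) = wordProbability h n (m + 1) := by
  rw [wordProbability, hex.outputIntegral_iterate_comm _ _ _
    (measurable_iterate_outputIntegral _ _ measurable_one), wordProbability,
    Function.iterate_succ_apply' (outputIntegral h false) m]

theorem ExchangeableKernel.wordProbability_eq_add [IsMarkovKernel h] (hex : ExchangeableKernel h)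
    (n m : ℕ) :
    wordProbability h n m = wordProbability h (n + 1) m + wordProbability h n (m + 1) := by
  have hone (b : Bool) : Measurable (outputIntegral h b 1) :=
    measurable_outputIntegral b measurable_one
  calc wordProbability h n m
      = (outputIntegral h true)^[n] ((outputIntegral h false)^[m]
          (outputIntegral h true 1 + outputIntegral h false 1)) := by
        rw [outputIntegral_true_one_add_false_one, wordProbability]
    _ = _ := by
        rw [iterate_outputIntegral_add _ _ (hone true), iterate_outputIntegral_add _ _
          (measurable_iterate_outputIntegral _ _ (hone true)),
          ← hex.outputIntegral_iterate_comm _ _ _ measurable_one]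
        rfl

theorem ExchangeableKernel.wordProbability_le_one [IsMarkovKernel h] (hex : ExchangeableKernel h)
    (n m : ℕ) : wordProbability h n m ≤ 1 := by
  induction n with
  | zero =>
    induction m with
    | zero => rfl
    | succ m ih =>
      refine le_trans ?_ ih
      rw [hex.wordProbability_eq_add 0 m]
      exact le_add_self
  | succ n ih =>
    refine le_trans ?_ ih
    rw [hex.wordProbability_eq_add n m]
    exact le_self_add

theorem ExchangeableKernel.wordProbability_ne_top [IsMarkovKernel h] (hex : ExchangeableKernel h)
    (n m : ℕ) (x : X) : wordProbability h n m x ≠ ∞ :=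
  ((hex.wordProbability_le_one n m x).trans_lt ENNReal.one_lt_top).ne

theorem ExchangeableKernel.exists_kernel_lintegral_pow_eq [IsMarkovKernel h]
    (hex : ExchangeableKernel h) :
    ∃ f : Kernel X I, IsMarkovKernel f ∧ ∀ (n : ℕ) (x : X),
      ∫⁻ r : I, ENNReal.ofReal ((r : ℝ) ^ n) ∂f x = wordProbability h n 0 x := by
  have hne := hex.wordProbability_ne_top
  choose μ hμ using fun x ↦ exists_probabilityMeasure_integral_pow_eq
    (fun n m ↦ (wordProbability h n m x).toReal) (fun _ _ ↦ ENNReal.toReal_nonneg)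
    (by simp [wordProbability_zero_zero]) fun n m ↦ by
      rw [← ENNReal.toReal_add (hne _ _ x) (hne _ _ x), ← Pi.add_apply,
        ← hex.wordProbability_eq_add]
  have hmeas : Measurable fun x ↦ (μ x : Measure I) :=
    measurable_of_forall_measurable_integral_pow fun n ↦ by
      simpa only [hμ] using (measurable_wordProbability n 0).ennreal_toReal
  refine ⟨⟨fun x ↦ μ x, hmeas⟩, ⟨fun x ↦ (μ x).2⟩, fun n x ↦ ?_⟩
  change ∫⁻ r : I, ENNReal.ofReal ((r : ℝ) ^ n) ∂(μ x : Measure I) = _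
  rw [← ofReal_integral_eq_lintegral_ofReal
    (integrable_pow_unitInterval _ n)
    (ae_of_all _ fun r ↦ pow_nonneg r.2.1 n), hμ, ENNReal.ofReal_toReal (hne _ _ x)]

end WordProbability

/-- The Bernoulli coalgebra `coin` is the final exchangeable coalgebra for the functor
`Bool × (−)` on the Kleisli category of the Giry monad: every exchangeable Markov-kernel
coalgebra `h : X ⤳ Bool × X` admits a unique Markov kernel `f : X ⤳ [0,1]` that is a
coalgebra homomorphism, i.e. `coin ∘ f = (id_Bool × f) ∘ h`. -/
theorem coin_final_exchangeable
    {X : Type*} [MeasurableSpace X]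
    (h : Kernel X (Bool × X)) [IsMarkovKernel h] (hex : ExchangeableKernel h) :
    ∃! f : Kernel X (Set.Icc (0 : ℝ) 1), IsMarkovKernel f ∧
      ∀ x : X,
        ((f x).bind coin) = (h x).bind fun p => (f p.2).map fun r => (p.1, r) := by
  have hsucc (n : ℕ) (r : I) :
      ENNReal.ofReal (r : ℝ) * ENNReal.ofReal ((r : ℝ) ^ n) = ENNReal.ofReal ((r : ℝ) ^ (n + 1)) := by
    rw [← ENNReal.ofReal_mul r.2.1, pow_succ']
  obtain ⟨f, hf, hmom⟩ := hex.exists_kernel_lintegral_pow_eq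
  refine ⟨f, ⟨hf, fun x ↦ ?_⟩, ?_⟩
  · refine (bind_coin_eq_bind_map_iff f x).2 fun b n ↦ ?_
    simp only [hmom]
    have htrue : ∫⁻ r : I, ENNReal.ofReal (r : ℝ) * ENNReal.ofReal ((r : ℝ) ^ n) ∂f x
        = wordProbability h (n + 1) 0 x := by
      simp only [hsucc, hmom]
    cases b with
    | true =>
      simp only [if_true, htrue]
      exact (congrFun (outputIntegral_true_wordProbability n 0) x).symm
    | false =>
      refine (ENNReal.add_right_inj (hex.wordProbability_ne_top (n + 1) 0 x)).1 ?_
      refine Eq.trans ?_ (congrFun (hex.wordProbability_eq_add n 0) x |>.trans ?_)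
      · rw [← htrue, ← lintegral_add_left (by fun_prop), ← hmom]
        refine lintegral_congr fun r ↦ ?_
        simp only [Bool.false_eq_true, if_false]
        rw [← add_mul, ← ENNReal.ofReal_add r.2.1 (sub_nonneg.2 r.2.2), add_sub_cancel,
          ENNReal.ofReal_one, one_mul]
      · rw [Pi.add_apply, ← hex.outputIntegral_false_wordProbability]
  · rintro g ⟨hg, hghom⟩
    have hgmom (n : ℕ) : (fun x ↦ ∫⁻ r : I, ENNReal.ofReal ((r : ℝ) ^ n) ∂g x)
        = wordProbability h n 0 := by
      induction n with
      | zero => ext x; simp [wordProbability_zero_zero]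
      | succ n ih =>
        rw [← outputIntegral_true_wordProbability, ← ih]
        ext x
        have := (bind_coin_eq_bind_map_iff g x).1 (hghom x) true n
        simpa only [if_true, hsucc] using this
    ext1 x
    refine ext_of_forall_lintegral_pow_eq fun n ↦ ?_
    rw [hmom, ← hgmom]
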